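/- arXiv:2303.02522 — 3 statements merged into one kernel-verified Lean document; each statement's English description precedes it below -/
import Mathlib

section
/- Let r = (v_0 = 0, v_1, …, v_k) be a route with a feasible schedule u that serves rider l, meaning l's pickup node and dropoff node both appear among v_1, …, v_k with the pickup before the dropoff. Let r̂ be the route obtained from r by deleting rider l's pickup and dropoff nodes, and let û be the restriction of the schedule u to the remaining nodes. Then û is a feasible schedule for r̂: it satisfies the travel-time recursion for every consecutive pair of remaining nodes, all release-time constraints, all in-vehicle deviation constraints for the remaining riders (which are unchanged since their arrival times are unchanged), and all capacity constraints (the load at each remaining position is at most its load in r, hence at most Q). -/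
/-- Let `r = (v 0 = depot, v 1, …, v k)` be a route (a sequence of
distinct nodes) with a feasible schedule `u`: it satisfies the travel-time recursion
`u(v_{m+1}) ≥ u(v_m) + Δ(v_m) + t(v_m, v_{m+1})`, every rider's release-time
constraint `u(pick r) ≥ e r`, every rider's in-vehicle deviation constraint
`trip r ≤ u(drop r) − (u(pick r) + Δ(v(pick r))) ≤ max(α·trip r, β + trip r)`, and
the capacity constraint that the load at every position is at most `Q`.  Travel times
`t ≥ 0` satisfy the triangle inequality, `Δ ≥ 0`, `q ≥ 0`, `trip > 0`, `α ≥ 1`,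
`β ≥ 0`, `Q > 0`; riders' pickup and dropoff positions are among `v 1, …, v k`, the
pickup strictly before the dropoff, distinct riders occupying distinct positions.

Let `r̂` be the route obtained by deleting rider `l`'s pickup and dropoff positions
(`S` is the set of remaining positions) and let `û` be the restriction of `u` to the
remaining positions.  Then `û` is a feasible schedule for `r̂`: the travel-time
recursion holds for every pair of consecutive *remaining* positions, all release-time
constraints hold, all in-vehicle deviation constraints of the remaining riders hold
(unchanged, since their arrival times are unchanged), and the load at each remaining
position (now counting only riders other than `l`) is at most `Q`. -/
theorem deleted_rider_schedule_feasible
    {Node : Type*}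
    (t : Node → Node → ℝ) (Δ : Node → ℝ)
    (ht : ∀ a b, 0 ≤ t a b)
    (htri : ∀ a b c, t a c ≤ t a b + t b c)
    (hΔ : ∀ b, 0 ≤ Δ b)
    (k : ℕ) (v : Fin (k + 1) → Node) (hv : Function.Injective v)
    (depot : Node) (hdepot : v 0 = depot)
    {R : Type*} [Fintype R] [DecidableEq R]
    (q e trip : R → ℝ)
    (pick drop : R → Fin (k + 1))
    (hq : ∀ r, 0 ≤ q r) (htrip : ∀ r, 0 < trip r)
    (hpd : ∀ r, pick r < drop r)
    (hpos : ∀ r, 0 < (pick r).val)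
    (hdistinct : Function.Injective (Sum.elim pick drop : R ⊕ R → Fin (k + 1)))
    (α β Qcap : ℝ) (hα : 1 ≤ α) (hβ : 0 ≤ β) (hQ : 0 < Qcap)
    (u : Fin (k + 1) → ℝ)
    (hrec : ∀ m : ℕ, (hm : m < k) →
      u ⟨m + 1, by omega⟩ ≥ u ⟨m, by omega⟩ + Δ (v ⟨m, by omega⟩) +
        t (v ⟨m, by omega⟩) (v ⟨m + 1, by omega⟩))
    (hrel : ∀ r, u (pick r) ≥ e r)
    (hdev : ∀ r, trip r ≤ u (drop r) - (u (pick r) + Δ (v (pick r))) ∧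
      u (drop r) - (u (pick r) + Δ (v (pick r))) ≤ max (α * trip r) (β + trip r))
    (hload : ∀ m : Fin (k + 1),
      (∑ r : R, if pick r ≤ m ∧ m < drop r then q r else 0) ≤ Qcap)
    (l : R)
    (S : Finset (Fin (k + 1))) (hS : S = Finset.univ \ {pick l, drop l}) :
    -- travel-time recursion between consecutive remaining positions
    (∀ a ∈ S, ∀ b ∈ S, a < b → (∀ c ∈ S, ¬(a < c ∧ c < b)) →
        u b ≥ u a + Δ (v a) + t (v a) (v b)) ∧
    -- release-time constraints of the remaining riders
    (∀ r : R, r ≠ l → u (pick r) ≥ e r) ∧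
    -- in-vehicle deviation constraints of the remaining riders
    (∀ r : R, r ≠ l →
        trip r ≤ u (drop r) - (u (pick r) + Δ (v (pick r))) ∧
        u (drop r) - (u (pick r) + Δ (v (pick r))) ≤ max (α * trip r) (β + trip r)) ∧
    -- capacity constraints at every remaining position
    (∀ m ∈ S, (∑ r : R, if r ≠ l ∧ pick r ≤ m ∧ m < drop r then q r else 0) ≤ Qcap) := by
  have key : ∀ (a d : ℕ) (h : a + d + 1 < k + 1),
      u ⟨a + d + 1, h⟩ ≥ u ⟨a, by omega⟩ + Δ (v ⟨a, by omega⟩) +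
        t (v ⟨a, by omega⟩) (v ⟨a + d + 1, h⟩) := by
    intro a d
    induction d with
    | zero => intro h; exact hrec a (by omega)
    | succ d ih =>
      intro h
      have h1 := ih (by omega)
      have h2 := hrec (a + d + 1) (by omega)
      have h3 := htri (v ⟨a, by omega⟩) (v ⟨a + d + 1, by omega⟩) (v ⟨a + d + 1 + 1, h⟩)
      have h4 := hΔ (v ⟨a + d + 1, by omega⟩)
      change u ⟨a + d + 1 + 1, h⟩ ≥ u ⟨a, by omega⟩ + Δ (v ⟨a, by omega⟩) +
        t (v ⟨a, by omega⟩) (v ⟨a + d + 1 + 1, h⟩)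
      linarith
  refine ⟨?_, fun r _ => hrel r, fun r _ => hdev r, ?_⟩
  · rintro ⟨a, ha⟩ _ ⟨b, hb⟩ _ hab _
    have hab' : a < b := hab
    obtain ⟨d, rfl⟩ : ∃ d, b = a + d + 1 := ⟨b - a - 1, by omega⟩
    exact key a d hb
  · intro m _
    refine le_trans (Finset.sum_le_sum fun r _ => ?_) (hload m)
    by_cases h : pick r ≤ m ∧ m < drop r
    · by_cases hr : r = l
      · simp [hr, h, hq]
        split_ifs <;> simp [hq]
      · simp [hr, h]
    · rw [if_neg h, if_neg (fun h' => h h'.2)]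
end

section
/- Let v_0, v_1, …, v_k be a sequence of nodes with earliest-arrival times defined recursively by u(v_0) = u_0 and u(v_{m+1}) = max(e_{v_{m+1}}, u(v_m) + Δ_{v_m} + t(v_m, v_{m+1})), where each node b has release time e_b and service duration Δ_b ≥ 0, and the travel times t ≥ 0 satisfy the triangle inequality. Let the sequence obtained by deleting one interior node v_p (0 < p ≤ k) have earliest-arrival times û defined by the same recursion with the same initial time u_0. Then û(v_m) ≤ u(v_m) for every remaining node v_m of the shortened sequence. -/
/-- Earliest-arrival times of a node sequence `seq` started at time `u0`:
`u(v_0) = max(e_{v_0}, u_0)` and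
`u(v_{m+1}) = max(e_{v_{m+1}}, u(v_m) + Δ_{v_m} + t(v_m, v_{m+1}))`. -/
noncomputable def earliestArrival {Node : Type*} (t : Node → Node → ℝ) (Δ : Node → ℝ)
    (e : Node → ℝ) (u0 : ℝ) (seq : ℕ → Node) : ℕ → ℝ
  | 0 => max (e (seq 0)) u0
  | m + 1 => max (e (seq (m + 1)))
      (earliestArrival t Δ e u0 seq m + Δ (seq m) + t (seq m) (seq (m + 1)))

/-- Let `v 0, …, v k` be a node sequence with earliest-arrival times `u`
given by the above recursion (release times `e`, service durations `Δ ≥ 0`, travel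
times `t ≥ 0` satisfying the triangle inequality).  Let `w` be the sequence obtained
by deleting one interior node `v p` (`0 < p ≤ k`), with earliest-arrival times `û`
given by the same recursion and the same initial time `u0`.  Then `û ≤ u` at every
remaining node: for every index `m < k` of the shortened sequence,
`û(w m) ≤ u` at the corresponding original node (`v m` if `m < p`, `v (m+1)` else). -/
theorem earliest_arrival_after_deletion_le
    {Node : Type*}
    (t : Node → Node → ℝ) (Δ : Node → ℝ) (e : Node → ℝ)
    (ht : ∀ a b, 0 ≤ t a b)
    (htri : ∀ a b c, t a c ≤ t a b + t b c)
    (hΔ : ∀ b, 0 ≤ Δ b)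
    (k p : ℕ) (hp0 : 0 < p) (hpk : p ≤ k)
    (v : ℕ → Node) (u0 : ℝ)
    (w : ℕ → Node) (hw : ∀ m, w m = if m < p then v m else v (m + 1)) :
    ∀ m, m < k →
      earliestArrival t Δ e u0 w m ≤
        earliestArrival t Δ e u0 v (if m < p then m else m + 1) := by
  intro m
  induction m with
  | zero =>
    intro _
    simp [earliestArrival, hw, hp0]
  | succ m ih =>
    intro hm
    have ih := ih (by omega)
    by_cases h1 : m + 1 < p
    · have h2 : m < p := by omega
      simp only [h1, h2, if_true] at ih ⊢
      simp only [earliestArrival, hw, h1, h2, if_true]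
      exact max_le_max le_rfl (by linarith)
    · by_cases h2 : m < p
      · simp only [h1, h2, if_true, if_false] at ih ⊢
        simp only [earliestArrival, hw, h1, h2, if_true, if_false]
        refine max_le_max le_rfl ?_
        have h3 := le_max_right (e (v (m + 1)))
          (earliestArrival t Δ e u0 v m + Δ (v m) + t (v m) (v (m + 1)))
        have h4 := htri (v m) (v (m + 1)) (v (m + 1 + 1))
        have h5 := hΔ (v (m + 1))
        linarith
      · simp only [h1, h2, if_false] at ih ⊢
        rw [earliestArrival, earliestArrival.eq_2 t Δ e u0 v (m + 1)]
        simp only [hw, h1, h2, if_false]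
        exact max_le_max le_rfl (by linarith)
end

section
/- Let v_0, v_1, …, v_k be a sequence of nodes with arrival times defined by the pure recursion u(v_0) = u_0 and u(v_{m+1}) = u(v_m) + Δ_{v_m} + t(v_m, v_{m+1}), where Δ ≥ 0 and the travel times t ≥ 0 satisfy the triangle inequality. Let the sequence obtained by deleting one interior node v_p (0 < p < k) have arrival times û defined by the same recursion with the same initial time. Then for any two remaining nodes v_a and v_b with a < b, the elapsed time between them does not increase: û(v_b) − û(v_a) ≤ u(v_b) − u(v_a). In particular, the in-vehicle time of any rider whose pickup and dropoff both remain on the shortened route does not increase. -/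
/-- Arrival times of a node sequence `seq` started at time `u0`, by the pure
recursion `u(v_0) = u_0`, `u(v_{m+1}) = u(v_m) + Δ_{v_m} + t(v_m, v_{m+1})`. -/
noncomputable def pureArrival {Node : Type*} (t : Node → Node → ℝ) (Δ : Node → ℝ)
    (u0 : ℝ) (seq : ℕ → Node) : ℕ → ℝ
  | 0 => u0
  | m + 1 => pureArrival t Δ u0 seq m + Δ (seq m) + t (seq m) (seq (m + 1))

/-- Let `v 0, …, v k` be a node sequence with arrival times `u` given by
the pure recursion (service durations `Δ ≥ 0`, travel times `t ≥ 0` satisfying the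
triangle inequality).  Let `w` be the sequence obtained by deleting one interior node
`v p` (`0 < p < k`), with arrival times `û` given by the same recursion with the same
initial time.  Then for any two remaining nodes (indices `a < b < k` of the shortened
sequence, corresponding to original indices `a` resp. `a+1` and `b` resp. `b+1`), the
elapsed time between them does not increase: `û(b) − û(a) ≤ u(b') − u(a')`.
In particular, the in-vehicle time of any rider whose pickup and dropoff both remain
on the shortened route does not increase. -/
theorem elapsed_time_after_deletion_le
    {Node : Type*}
    (t : Node → Node → ℝ) (Δ : Node → ℝ)
    (ht : ∀ a b, 0 ≤ t a b)
    (htri : ∀ a b c, t a c ≤ t a b + t b c)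
    (hΔ : ∀ b, 0 ≤ Δ b)
    (k p : ℕ) (hp0 : 0 < p) (hpk : p < k)
    (v : ℕ → Node) (u0 : ℝ)
    (w : ℕ → Node) (hw : ∀ m, w m = if m < p then v m else v (m + 1)) :
    ∀ a b : ℕ, a < b → b < k →
      pureArrival t Δ u0 w b - pureArrival t Δ u0 w a ≤
        pureArrival t Δ u0 v (if b < p then b else b + 1) -
          pureArrival t Δ u0 v (if a < p then a else a + 1) := by
  intro a b hab _
  have hmono : Monotone (fun m : ℕ =>
      pureArrival t Δ u0 v (if m < p then m else m + 1) - pureArrival t Δ u0 w m) := by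
    apply monotone_nat_of_le_succ
    intro m
    have e : pureArrival t Δ u0 w (m + 1)
        = pureArrival t Δ u0 w m + Δ (w m) + t (w m) (w (m + 1)) := rfl
    have e1 : ∀ n, pureArrival t Δ u0 v (n + 1)
        = pureArrival t Δ u0 v n + Δ (v n) + t (v n) (v (n + 1)) := fun _ => rfl
    simp only [e, hw]
    rcases lt_trichotomy (m + 1) p with h | h | h
    · have h' : m < p := by omega
      simp only [h, h', if_true, e1]
      linarith
    · have h' : m < p := by omega
      have h2 : ¬ (m + 1 < p) := by omega
      simp only [h2, h', if_true, if_false, e1]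
      linarith [htri (v m) (v (m + 1)) (v (m + 1 + 1)), hΔ (v (m + 1))]
    · have h' : ¬ m < p := by omega
      have h2 : ¬ (m + 1 < p) := by omega
      simp only [h2, h', if_false, e1]
      linarith
  have h := hmono hab.le
  simp only at h
  linarith
end
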